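/- arXiv:2408.06611 — 3 statements merged into one kernel-verified Lean document; each statement's English description precedes it below -/
import Mathlib

section
/- Let G be a finite group and let s, t ∈ G. Then |κ(s)| · |{u ∈ G : us = su and u is conjugate to t}| = |κ(t)| · |{u ∈ G : ut = tu and u is conjugate to s}|. Consequently the lumped transition matrix P(C,C') = |C_G(s) ∩ C'| / |C_G(s)| (for s ∈ C) of the commuting-graph walk on conjugacy classes is well defined and symmetric: P(C,C') = P(C',C) for all conjugacy classes C, C' of G. -/
namespace Stmt3

/-- The lumped kernel of the commuting-graph walk:
`P(s, t) = |C_G(s) ∩ κ(t)| / |C_G(s)|`, the probability that a uniform element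
commuting with `s` lies in the conjugacy class of `t`. -/
noncomputable def lumpedP {G : Type*} [Group G] (s t : G) : ℝ :=
  (Nat.card {u : G | u * s = s * u ∧ IsConj t u} : ℝ) / Nat.card {u : G | u * s = s * u}

theorem card_comm_conj {G : Type*} [Group G] {s s' : G} (h : IsConj s s') (t : G) :
    Nat.card {u : G | u * s = s * u ∧ IsConj t u}
      = Nat.card {u : G | u * s' = s' * u ∧ IsConj t u} := by
  obtain ⟨c, rfl⟩ := isConj_iff.1 h
  refine Nat.card_congr ((MulAut.conj c).toEquiv.subtypeEquiv fun u => ?_)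
  have h1 : IsConj u (c * u * c⁻¹) := isConj_iff.2 ⟨c, rfl⟩
  simp only [Set.mem_setOf_eq, MulEquiv.toEquiv_eq_coe, EquivLike.coe_coe, MulAut.conj_apply]
  refine and_congr ?_ ⟨fun h => h.trans h1, fun h => h.trans h1.symm⟩
  constructor
  · intro h
    calc c * u * c⁻¹ * (c * s * c⁻¹) = c * (u * s) * c⁻¹ := by group
      _ = c * (s * u) * c⁻¹ := by rw [h]
      _ = _ := by group
  · intro h
    calc u * s = c⁻¹ * (c * u * c⁻¹ * (c * s * c⁻¹)) * c := by group
      _ = c⁻¹ * (c * s * c⁻¹ * (c * u * c⁻¹)) * c := by rw [h]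
      _ = _ := by group

theorem card_pairs {G : Type*} [Group G] [Finite G] (s t : G) :
    Nat.card {v : G | IsConj s v} * Nat.card {u : G | u * s = s * u ∧ IsConj t u}
      = Nat.card {p : G × G | IsConj s p.1 ∧ IsConj t p.2 ∧ p.2 * p.1 = p.1 * p.2} := by
  classical
  have := Fintype.ofFinite G
  let e : {p : G × G | IsConj s p.1 ∧ IsConj t p.2 ∧ p.2 * p.1 = p.1 * p.2} ≃
      Σ v : {v : G | IsConj s v}, {u : G | u * v.1 = v.1 * u ∧ IsConj t u} :=
    { toFun := fun p => ⟨⟨p.1.1, p.2.1⟩, ⟨p.1.2, p.2.2.2, p.2.2.1⟩⟩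
      invFun := fun q => ⟨(q.1.1, q.2.1), q.1.2, q.2.2.2, q.2.2.1⟩
      left_inv := fun _ => rfl
      right_inv := fun _ => rfl }
  rw [Nat.card_congr e, Nat.card_sigma,
    Finset.sum_congr rfl fun v _ => (card_comm_conj v.2 t).symm]
  simp [Nat.card_eq_fintype_card]

theorem count_symm {G : Type*} [Group G] [Finite G] (s t : G) :
    Nat.card {v : G | IsConj s v} * Nat.card {u : G | u * s = s * u ∧ IsConj t u}
      = Nat.card {v : G | IsConj t v} * Nat.card {u : G | u * t = t * u ∧ IsConj s u} := by
  rw [card_pairs, card_pairs]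
  refine Nat.card_congr ((Equiv.prodComm G G).subtypeEquiv fun p => ?_)
  simp only [Set.mem_setOf_eq, Equiv.prodComm_apply, Prod.fst_swap, Prod.snd_swap]
  rw [eq_comm (a := p.2 * p.1)]
  tauto

theorem orbit_stab {G : Type*} [Group G] [Finite G] (s : G) :
    Nat.card {v : G | IsConj s v} * Nat.card {u : G | u * s = s * u} = Nat.card G := by
  have h := Nat.card_congr (MulAction.orbitProdStabilizerEquivGroup (ConjAct G) s)
  rw [Nat.card_prod] at h
  have h1 : Nat.card {v : G | IsConj s v} = Nat.card (MulAction.orbit (ConjAct G) s) := by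
    congr 2
    ext v
    rw [ConjAct.mem_orbit_conjAct]
    exact isConj_comm
  have h2 : Nat.card {u : G | u * s = s * u} = Nat.card (MulAction.stabilizer (ConjAct G) s) := by
    refine Nat.card_congr (ConjAct.toConjAct.toEquiv.subtypeEquiv fun u => ?_)
    simp [MulAction.mem_stabilizer_iff, ConjAct.smul_def, mul_inv_eq_iff_eq_mul]
  rw [h1, h2, h]
  exact Nat.card_congr ConjAct.ofConjAct.toEquiv

theorem lumpedP_eq {G : Type*} [Group G] [Finite G] (s t : G) :
    lumpedP s t = ((Nat.card {v : G | IsConj s v} *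
      Nat.card {u : G | u * s = s * u ∧ IsConj t u} : ℕ) : ℝ) / Nat.card G := by
  have h := orbit_stab s
  have h0 : Nat.card G ≠ 0 := Nat.card_pos.ne'
  have hk : (Nat.card {v : G | IsConj s v} : ℝ) ≠ 0 := by
    intro hz
    rw [Nat.cast_eq_zero] at hz
    rw [hz, zero_mul] at h
    exact h0 h.symm
  rw [← h, lumpedP]
  push_cast
  rw [mul_div_mul_left _ _ hk]

theorem lumpedP_symm {G : Type*} [Group G] [Finite G] (s t : G) :
    lumpedP s t = lumpedP t s := by
  rw [lumpedP_eq, lumpedP_eq, count_symm]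

theorem lumpedP_congr_left {G : Type*} [Group G] [Finite G] {s s' : G} (h : IsConj s s') (t : G) :
    lumpedP s t = lumpedP s' t := by
  have h1 : {v : G | IsConj s v} = {v : G | IsConj s' v} := by
    ext v
    exact ⟨fun k => h.symm.trans k, fun k => h.trans k⟩
  rw [lumpedP_eq, lumpedP_eq, card_comm_conj h, h1]

theorem stmt3 (G : Type*) [Group G] [Finite G] :
    -- the counting identity
    (∀ s t : G,
      Nat.card {v : G | IsConj s v} * Nat.card {u : G | u * s = s * u ∧ IsConj t u}
        = Nat.card {v : G | IsConj t v} * Nat.card {u : G | u * t = t * u ∧ IsConj s u}) ∧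
    -- the lumped matrix is well defined on conjugacy classes
    (∀ s s' t t' : G, IsConj s s' → IsConj t t' → lumpedP s t = lumpedP s' t') ∧
    -- and symmetric
    (∀ s t : G, lumpedP s t = lumpedP t s) := by
  refine ⟨count_symm, fun s s' t t' hs ht => ?_, lumpedP_symm⟩
  rw [lumpedP_congr_left hs, lumpedP_symm, lumpedP_congr_left ht, lumpedP_symm]

end Stmt3
end

section
/- Fix k, n ≥ 1, a subgroup Γ of Perm(Fin k) and a subgroup H of Perm(Fin n). For every real number x, (1/(|Γ|^n · |H|)) · Σ_{γ : Fin n → Γ} Σ_{h ∈ H} x^{C(W(γ,h))} = (1/|H|) · Σ_{h ∈ H} ( (1/|Γ|) · Σ_{g ∈ Γ} x^{C(g)} )^{C(h)}. Equivalently, for σ uniform in Γ^n ⋊ H, the number of cycles C(σ) is distributed as a sum Σ_{i=1}^N X_i of i.i.d. copies X_i of the cycle count of a uniform element of Γ, stopped at an independent N distributed as the cycle count of a uniform element of H. -/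
open scoped BigOperators

namespace Stmt4

/-- Total number of cycles (orbits) of a permutation, counting fixed points
as cycles of length 1. -/
def totalCycles {α : Type*} [Fintype α] [DecidableEq α] (π : Equiv.Perm α) : ℕ :=
  (Fintype.card α - π.support.card) + Multiset.card π.cycleType

/-- The wreath permutation `W(γ,h)(i,j) = (γ_j(i), h(j))` of `Fin k × Fin n`. -/
def wreath {k n : ℕ} (γ : Fin n → Equiv.Perm (Fin k)) (h : Equiv.Perm (Fin n)) :
    Equiv.Perm (Fin k × Fin n) where
  toFun p := (γ p.2 p.1, h p.2)
  invFun p := ((γ (h.symm p.2)).symm p.1, h.symm p.2)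
  left_inv := by rintro ⟨i, j⟩; simp
  right_inv := by rintro ⟨i, j⟩; simp

open Classical in
/-- Number of invariant colourings. -/
theorem card_inv {α Y : Type*} [Fintype α] [DecidableEq α] [Finite Y] (π : Equiv.Perm α) :
    Nat.card {f : α → Y // ∀ x, f (π x) = f x} = Nat.card Y ^ totalCycles π := by
  let T := π.cycleFactorsFinset ⊕ {x // x ∉ π.support}
  let p : α → T := fun x =>
    if hx : x ∈ π.support then
      Sum.inl ⟨π.cycleOf x, Equiv.Perm.cycleOf_mem_cycleFactorsFinset_iff.2 hx⟩
    else Sum.inr ⟨x, hx⟩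
  have hsurj : Function.Surjective p := by
    rintro (⟨c, hc⟩ | ⟨x, hx⟩)
    · have hc' := Equiv.Perm.mem_cycleFactorsFinset_iff.1 hc
      obtain ⟨x, hx⟩ := hc'.1.nonempty_support
      have hxs : x ∈ π.support := Equiv.Perm.mem_cycleFactorsFinset_support_le hc hx
      refine ⟨x, ?_⟩
      simp only [p, hxs, dite_true]
      congr 2
      exact (Equiv.Perm.cycle_is_cycleOf hx hc).symm
    · exact ⟨x, by simp only [p, hx, dite_false]⟩
  have hp : ∀ x, p (π x) = p x := by
    intro x
    by_cases hx : x ∈ π.support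
    · have hx' : π x ∈ π.support := Equiv.Perm.apply_mem_support.2 hx
      simp only [p, hx, hx', dite_true]
      congr 2
      exact Equiv.Perm.SameCycle.cycleOf_eq (Equiv.Perm.sameCycle_apply_left.2 (Equiv.Perm.SameCycle.refl _ _))
    · rw [Equiv.Perm.notMem_support.1 hx]
  have hsame : ∀ x y, p x = p y → π.SameCycle x y := by
    intro x y h
    by_cases hx : x ∈ π.support <;> by_cases hy : y ∈ π.support <;>
      simp only [p, hx, hy, dite_true, dite_false, reduceCtorEq] at h
    · have h := congrArg Subtype.val (Sum.inl.inj h)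
      dsimp only at h
      have h1 : y ∈ (π.cycleOf x).support := by
        rw [h, Equiv.Perm.mem_support_cycleOf_iff]
        exact ⟨Equiv.Perm.SameCycle.refl _ _, hy⟩
      exact (Equiv.Perm.mem_support_cycleOf_iff.1 h1).1
    · have h : x = y := congrArg Subtype.val (Sum.inr.inj h)
      subst h; exact Equiv.Perm.SameCycle.refl _ _
  have hcard : Nat.card T = totalCycles π := by
    rw [Nat.card_eq_fintype_card]
    simp only [T, Fintype.card_sum, Fintype.card_coe, totalCycles]
    rw [Equiv.Perm.cycleType_def, Multiset.card_map, Fintype.card_subtype_compl, Fintype.card_coe,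
      add_comm]
    rfl
  rw [← hcard, ← Nat.card_fun]
  symm
  refine Nat.card_congr (Equiv.ofBijective
    (fun u : T → Y => (⟨u ∘ p, fun x => by simp [hp]⟩ : {f : α → Y // ∀ x, f (π x) = f x})) ⟨?_, ?_⟩)
  · intro u v huv
    exact hsurj.injective_comp_right (congrArg Subtype.val huv)
  · rintro ⟨f, hf⟩
    have hz : ∀ (i : ℤ) x, f ((π ^ i) x) = f x := by
      intro i
      induction i with
      | zero => simp
      | succ i ih => intro x; rw [add_comm, zpow_add, zpow_one, Equiv.Perm.mul_apply, hf, ih]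
      | pred i ih =>
        intro x
        rw [← hf, ← Equiv.Perm.mul_apply, ← zpow_one_add, add_sub_cancel, ih]
    refine ⟨fun t => f (hsurj t).choose, Subtype.ext (funext fun x => ?_)⟩
    obtain ⟨i, hi⟩ := hsame _ _ (hsurj (p x)).choose_spec
    simp only [Function.comp]
    exact (hz i _).symm.trans (congrArg f hi)

open Classical in
theorem card_trans {G Y : Type*} [Group G] [Fintype G] [MulAction G Y] (y z : Y)
    (h : ∃ g : G, g • y = z) :
    (Finset.univ.filter fun g : G => g • y = z).card
      = (Finset.univ.filter fun g : G => g • y = y).card := by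
  obtain ⟨a, rfl⟩ := h
  refine Finset.card_bij' (fun g _ => a⁻¹ * g) (fun g _ => a * g) ?_ ?_ ?_ ?_ <;>
    simp +contextual [mul_smul]

open Classical in
theorem card_trans' {G Y : Type*} [Group G] [Fintype G] [MulAction G Y] (y z : Y)
    (h : ∃ g : G, g • y = z) :
    (Finset.univ.filter fun g : G => g • y = z).card
      = (Finset.univ.filter fun g : G => g • z = z).card := by
  obtain ⟨a, rfl⟩ := h
  refine Finset.card_bij' (fun g _ => g * a⁻¹) (fun g _ => g * a) ?_ ?_ ?_ ?_ <;>
    simp +contextual [mul_smul]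

open Classical in
theorem sum_stab {G Y : Type*} [Group G] [Fintype G] [Fintype Y] [MulAction G Y]
    (q : MulAction.orbitRel.Quotient G Y) :
    ∑ y ∈ Finset.univ.filter (fun y : Y => (Quotient.mk'' y : MulAction.orbitRel.Quotient G Y) = q),
      (Finset.univ.filter fun g : G => g • y = y).card = Fintype.card G := by
  induction q using Quotient.inductionOn' with
  | h y0 =>
    have hmem : ∀ y : Y, (Quotient.mk'' y : MulAction.orbitRel.Quotient G Y) = Quotient.mk'' y0 ↔
        ∃ g : G, g • y0 = y := by
      intro y
      rw [Quotient.eq'', MulAction.orbitRel_apply]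
      rfl
    have := Finset.card_eq_sum_card_fiberwise (s := (Finset.univ : Finset G))
      (t := Finset.univ.filter
        (fun y : Y => (Quotient.mk'' y : MulAction.orbitRel.Quotient G Y) = Quotient.mk'' y0))
      (f := fun g => g • y0) (by
        intro g _
        simp only [Finset.coe_filter, Finset.mem_univ, true_and, Set.mem_setOf_eq]
        exact (hmem _).2 ⟨g, rfl⟩)
    rw [← Finset.card_univ, this]
    refine Finset.sum_congr rfl fun y hy => ?_
    rw [card_trans' y0 y ((hmem y).1 (by simpa using hy))]

open Classical in
theorem count_pairs {G Y : Type*} [Group G] [Fintype G] [Fintype Y] [MulAction G Y] {n : ℕ}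
    (h : Equiv.Perm (Fin n)) :
    ∑ γ : Fin n → G, Nat.card {c : Fin n → Y // ∀ j, γ j • c j = c (h j)}
      = Fintype.card G ^ n * Nat.card (MulAction.orbitRel.Quotient G Y) ^ totalCycles h := by
  let Q := MulAction.orbitRel.Quotient G Y
  let mk : Y → Q := fun y => Quotient.mk'' y
  let s : Y → ℕ := fun y => (Finset.univ.filter fun g : G => g • y = y).card
  have hmem : ∀ y z : Y, mk z = mk y ↔ ∃ g : G, g • y = z := by
    intro y z
    simp only [mk]
    rw [Quotient.eq'', MulAction.orbitRel_apply]
    rfl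
  have hA : ∀ y z : Y, (Finset.univ.filter fun g : G => g • y = z).card
      = if mk z = mk y then s y else 0 := by
    intro y z
    split_ifs with hyz
    · exact card_trans y z ((hmem y z).1 hyz)
    · rw [Finset.card_eq_zero, Finset.filter_eq_empty_iff]
      intro g _ hg
      exact hyz ((hmem y z).2 ⟨g, hg⟩)
  calc ∑ γ : Fin n → G, Nat.card {c : Fin n → Y // ∀ j, γ j • c j = c (h j)}
      = ∑ γ : Fin n → G, ∑ c : Fin n → Y, if (∀ j, γ j • c j = c (h j)) then 1 else 0 := by
        refine Finset.sum_congr rfl fun γ _ => ?_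
        rw [Nat.card_eq_fintype_card, Fintype.card_subtype, Finset.card_filter]
    _ = ∑ c : Fin n → Y, ∑ γ : Fin n → G, if (∀ j, γ j • c j = c (h j)) then 1 else 0 :=
        Finset.sum_comm
    _ = ∑ c : Fin n → Y, ∏ j, if mk (c (h j)) = mk (c j) then s (c j) else 0 := by
        refine Finset.sum_congr rfl fun c _ => ?_
        simp_rw [← hA]
        rw [← Finset.card_filter, ← Fintype.card_piFinset]
        congr 1
        ext γ
        simp
    _ = ∑ c : Fin n → Y, if (∀ j, mk (c (h j)) = mk (c j)) then ∏ j, s (c j) else 0 := by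
        refine Finset.sum_congr rfl fun c _ => ?_
        rw [Finset.prod_ite_zero]
        simp
    _ = ∑ q : Fin n → Q, ∑ c : Fin n → Y with (fun j => mk (c j)) = q,
          if (∀ j, mk (c (h j)) = mk (c j)) then ∏ j, s (c j) else 0 := by
        rw [Finset.sum_fiberwise]
    _ = ∑ q : Fin n → Q, if (∀ j, q (h j) = q j) then Fintype.card G ^ n else 0 := by
        refine Finset.sum_congr rfl fun q _ => ?_
        split_ifs with hq
        · have h1 : Fintype.card G ^ n = ∏ j : Fin n,
              ∑ y ∈ Finset.univ.filter (fun y : Y => mk y = q j), s y := by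
            rw [Finset.prod_congr rfl fun j _ => sum_stab (q j)]
            simp
          rw [h1, Finset.prod_univ_sum]
          refine Finset.sum_congr ?_ ?_
          · ext c; simp [funext_iff]
          · intro c hc
            rw [if_pos]
            intro j
            have hc' : ∀ i, mk (c i) = q i := by simpa using hc
            rw [hc', hc', hq]
        · refine Finset.sum_eq_zero fun c hc => ?_
          rw [if_neg]
          intro hj
          apply hq
          have hc' : (fun j => mk (c j)) = q := by simpa using hc
          subst hc'
          exact hj
    _ = _ := by
        rw [← Finset.sum_filter, Finset.sum_const, smul_eq_mul, mul_comm, ← card_inv,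
          Nat.card_eq_fintype_card, Fintype.card_subtype]

theorem nat_version (k n m : ℕ) (Γ : Subgroup (Equiv.Perm (Fin k))) [Fintype Γ]
    (h : Equiv.Perm (Fin n)) :
    ∃ N : ℕ, ∑ γ : Fin n → Γ, m ^ totalCycles (wreath (fun j => (γ j : Equiv.Perm (Fin k))) h)
        = Fintype.card Γ ^ n * N ^ totalCycles h ∧
      ∑ g : Γ, m ^ totalCycles (g : Equiv.Perm (Fin k)) = N * Fintype.card Γ := by
  classical
  letI : MulAction Γ (Fin k → Fin m) := arrowAction
  have hsm : ∀ (g : Γ) (y : Fin k → Fin m) (i : Fin k), (g • y) i = y ((g : Equiv.Perm (Fin k))⁻¹ i) :=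
    fun g y i => rfl
  have hsm' : ∀ (g : Γ) (y z : Fin k → Fin m), g • y = z ↔ ∀ i, z ((g : Equiv.Perm (Fin k)) i) = y i := by
    intro g y z
    constructor
    · rintro rfl i
      rw [hsm]; simp
    · intro hz
      ext1 i
      rw [hsm, ← hz]; simp
  refine ⟨Nat.card (MulAction.orbitRel.Quotient Γ (Fin k → Fin m)), ?_, ?_⟩
  · rw [← count_pairs h]
    refine Finset.sum_congr rfl fun γ _ => ?_
    have := card_inv (Y := Fin m) (wreath (fun j => (γ j : Equiv.Perm (Fin k))) h)
    rw [Nat.card_fin] at this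
    rw [← this]
    refine Nat.card_congr
      { toFun := fun f => ⟨fun j i => f.1 (i, j), fun j => (hsm' _ _ _).2 fun i => f.2 (i, j)⟩
        invFun := fun c => ⟨fun p => c.1 p.2 p.1, fun p => (hsm' _ _ _).1 (c.2 p.2) p.1⟩
        left_inv := fun f => rfl
        right_inv := fun c => rfl }
  · rw [Nat.card_eq_fintype_card,
      ← MulAction.sum_card_fixedBy_eq_card_orbits_mul_card_group Γ (Fin k → Fin m)]
    refine Finset.sum_congr rfl fun g _ => ?_
    have := card_inv (Y := Fin m) (g : Equiv.Perm (Fin k))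
    rw [Nat.card_fin] at this
    rw [← this, ← Nat.card_eq_fintype_card]
    exact Nat.card_congr (Equiv.subtypeEquivRight fun f => (hsm' g f f).symm)

theorem real_version (k n : ℕ) (Γ : Subgroup (Equiv.Perm (Fin k))) [Fintype Γ]
    (h : Equiv.Perm (Fin n)) (x : ℝ) :
    ∑ γ : Fin n → Γ, x ^ totalCycles (wreath (fun j => (γ j : Equiv.Perm (Fin k))) h)
      = (Nat.card Γ : ℝ) ^ n *
        ((1 / (Nat.card Γ : ℝ)) * ∑ g : Γ, x ^ totalCycles (g : Equiv.Perm (Fin k)))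
            ^ totalCycles h := by
  have key : (∑ γ : Fin n → Γ, (Polynomial.X : Polynomial ℝ) ^
        totalCycles (wreath (fun j => (γ j : Equiv.Perm (Fin k))) h))
      = Polynomial.C ((Nat.card Γ : ℝ) ^ n) *
        (Polynomial.C (1 / (Nat.card Γ : ℝ)) *
          ∑ g : Γ, Polynomial.X ^ totalCycles (g : Equiv.Perm (Fin k))) ^ totalCycles h := by
    apply Polynomial.eq_of_infinite_eval_eq
    refine (Set.infinite_range_of_injective (Nat.cast_injective (R := ℝ))).mono ?_
    rintro _ ⟨m, rfl⟩
    obtain ⟨N, h1, h2⟩ := nat_version k n m Γ h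
    have h1' := congrArg (Nat.cast (R := ℝ)) h1
    have h2' := congrArg (Nat.cast (R := ℝ)) h2
    push_cast at h1' h2'
    have hne : (Fintype.card Γ : ℝ) ≠ 0 := by exact_mod_cast Fintype.card_ne_zero
    simp only [Set.mem_setOf_eq, Polynomial.eval_finset_sum, Polynomial.eval_mul,
      Polynomial.eval_pow, Polynomial.eval_X, Polynomial.eval_C, Nat.card_eq_fintype_card]
    rw [h1', h2']
    congr 2
    field_simp
  have := congrArg (Polynomial.eval x) key
  simpa only [Polynomial.eval_finset_sum, Polynomial.eval_mul,
      Polynomial.eval_pow, Polynomial.eval_X, Polynomial.eval_C] using this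

/-- The generating function of the cycle count of a uniform element of `Γ^n ⋊ H` is the
generating function of `H` composed with that of `Γ`: equivalently, `C(σ)` is a stopped
sum of i.i.d. copies of the cycle count of a uniform element of `Γ`, stopped at an
independent cycle count of a uniform element of `H`. -/
theorem stmt4 (k n : ℕ) (hk : 1 ≤ k)
    (Γ : Subgroup (Equiv.Perm (Fin k))) (H : Subgroup (Equiv.Perm (Fin n)))
    [Fintype Γ] [Fintype H] (x : ℝ) :
    (1 / ((Nat.card Γ : ℝ) ^ n * Nat.card H)) *
        ∑ γ : Fin n → Γ, ∑ h : H,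
          x ^ totalCycles (wreath (fun j => (γ j : Equiv.Perm (Fin k))) (h : Equiv.Perm (Fin n)))
      = (1 / (Nat.card H : ℝ)) *
        ∑ h : H,
          ((1 / (Nat.card Γ : ℝ)) * ∑ g : Γ, x ^ totalCycles (g : Equiv.Perm (Fin k)))
            ^ totalCycles (h : Equiv.Perm (Fin n)) := by
  rw [Finset.sum_comm, Finset.sum_congr rfl fun (h : H) _ => real_version k n Γ (h : Equiv.Perm (Fin n)) x,
    ← Finset.mul_sum, ← mul_assoc]
  congr 1
  have hne : (Nat.card Γ : ℝ) ≠ 0 := by exact_mod_cast Nat.card_pos.ne'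
  have hne' : (Nat.card H : ℝ) ≠ 0 := by exact_mod_cast Nat.card_pos.ne'
  field_simp

end Stmt4
end

section
/- Let α and β be finite types, σ a permutation of α and τ a permutation of β, and let σ × τ denote the permutation of α × β given by (x,y) ↦ (σ(x), τ(y)) (Equiv.prodCongr σ τ). Then for every l ≥ 1, a_l(σ × τ) = Σ_{i,j ≥ 1 with lcm(i,j) = l} gcd(i,j) · a_i(σ) · a_j(τ): each pair consisting of an i-cycle of σ and a j-cycle of τ produces exactly gcd(i,j) cycles of σ × τ, each of length lcm(i,j). (This is the combinatorial content of the cycle index formula Z_{S_k × S_n}(x_1,…,x_{kn}) = Σ_{λ ⊢ k, μ ⊢ n} (1/(z_λ z_μ)) Π_{i,j} x_{lcm(i,j)}^{gcd(i,j)·a_i(λ)·a_j(μ)} for the product action of S_k × S_n on {1,…,k}×{1,…,n}.) -/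
open scoped BigOperators

namespace Stmt18

/-- Number of cycles of length `b` of a permutation, counting each fixed point
as a cycle of length 1. -/
def cycleCount {α : Type*} [Fintype α] [DecidableEq α] (π : Equiv.Perm α) (b : ℕ) : ℕ :=
  if b = 1 then Fintype.card α - π.support.card else Multiset.count b π.cycleType

lemma minPer_eq {α : Type*} [Fintype α] [DecidableEq α] (π : Equiv.Perm α) (x : α)
    (hx : x ∈ π.support) :
    Function.minimalPeriod π x = (π.cycleOf x).support.card := by
  have hc := π.isCycleOn_support_cycleOf x
  have hm : x ∈ (π.cycleOf x).support := by
    rw [Equiv.Perm.mem_support_cycleOf_iff]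
    exact ⟨Equiv.Perm.SameCycle.refl _ _, hx⟩
  have key : ∀ n, (Function.IsPeriodicPt π n x ↔ (π.cycleOf x).support.card ∣ n) := by
    intro n
    rw [← hc.pow_apply_eq hm, Function.IsPeriodicPt, Function.IsFixedPt,
      Equiv.Perm.iterate_eq_pow]
  apply Nat.dvd_antisymm
  · exact Function.IsPeriodicPt.minimalPeriod_dvd ((key _).2 dvd_rfl)
  · exact (key _).1 (Function.isPeriodicPt_minimalPeriod _ _)

lemma mul_cycleCount {α : Type*} [Fintype α] [DecidableEq α] (π : Equiv.Perm α) (b : ℕ)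
    (hb : 1 ≤ b) :
    b * cycleCount π b
      = (Finset.univ.filter (fun x => Function.minimalPeriod π x = b)).card := by
  unfold cycleCount
  split_ifs with h
  · subst h
    rw [one_mul, ← Finset.card_compl]
    congr 1
    ext x
    simp [Function.minimalPeriod_eq_one_iff_isFixedPt, Function.IsFixedPt]
  · have hsup : ∀ x, Function.minimalPeriod π x = b → x ∈ π.support := by
      intro x hx
      rw [Equiv.Perm.mem_support]
      intro h1
      apply h
      rw [← hx, Function.minimalPeriod_eq_one_iff_isFixedPt]
      exact h1
    rw [Equiv.Perm.cycleType_def, Multiset.count_map]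
    have hmaps : ∀ x ∈ Finset.univ.filter (fun x => Function.minimalPeriod π x = b),
        π.cycleOf x ∈ π.cycleFactorsFinset.filter (fun c => b = c.support.card) := by
      intro x hx
      have hx' := (Finset.mem_filter.1 hx).2
      rw [Finset.mem_filter, Equiv.Perm.cycleOf_mem_cycleFactorsFinset_iff]
      exact ⟨hsup x hx', by rw [← minPer_eq π x (hsup x hx'), hx']⟩
    rw [Finset.card_eq_sum_card_fiberwise hmaps]
    have : ∀ c ∈ π.cycleFactorsFinset.filter (fun c => b = c.support.card),
        ((Finset.univ.filter (fun x => Function.minimalPeriod π x = b)).filter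
          (fun x => π.cycleOf x = c)).card = b := by
      intro c hc
      obtain ⟨hc1, hc2⟩ := Finset.mem_filter.1 hc
      conv_rhs => rw [hc2]
      congr 1
      ext x
      simp only [Finset.mem_filter, Finset.mem_univ, true_and]
      constructor
      · rintro ⟨h1, rfl⟩
        rw [Equiv.Perm.mem_support_cycleOf_iff]
        exact ⟨Equiv.Perm.SameCycle.refl _ _, hsup x h1⟩
      · intro hx
        have h1 := Equiv.Perm.cycle_is_cycleOf hx hc1
        have h2 : x ∈ π.support := Equiv.Perm.mem_cycleFactorsFinset_support_le hc1 hx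
        exact ⟨by rw [minPer_eq π x h2, ← h1, hc2], h1.symm⟩
    rw [Finset.sum_congr rfl this, Finset.sum_const, smul_eq_mul, mul_comm]
    rfl

/-- Each pair consisting of an `i`-cycle of `σ` and a `j`-cycle of `τ` produces exactly
`gcd(i,j)` cycles of `σ × τ`, each of length `lcm(i,j)`; hence
`a_l(σ × τ) = Σ_{lcm(i,j) = l} gcd(i,j)·a_i(σ)·a_j(τ)`. -/
theorem stmt18 (α β : Type*) [Fintype α] [DecidableEq α] [Fintype β] [DecidableEq β]
    (σ : Equiv.Perm α) (τ : Equiv.Perm β) (l : ℕ) (hl : 1 ≤ l) :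
    cycleCount (Equiv.prodCongr σ τ) l
      = ∑ i ∈ l.divisors, ∑ j ∈ l.divisors,
          if Nat.lcm i j = l then Nat.gcd i j * cycleCount σ i * cycleCount τ j else 0 := by
  apply Nat.eq_of_mul_eq_mul_left hl
  rw [mul_cycleCount _ l hl]
  have hper : ∀ p : α × β, Function.minimalPeriod (Equiv.prodCongr σ τ) p
      = Nat.lcm (Function.minimalPeriod σ p.1) (Function.minimalPeriod τ p.2) := by
    intro p
    exact Function.minimalPeriod_prodMap σ τ p
  have hmaps : ∀ p ∈ Finset.univ.filter
      (fun p => Function.minimalPeriod (Equiv.prodCongr σ τ) p = l),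
      (Function.minimalPeriod σ p.1, Function.minimalPeriod τ p.2)
        ∈ l.divisors ×ˢ l.divisors := by
    intro p hp
    have hp' := (Finset.mem_filter.1 hp).2
    rw [hper] at hp'
    simp only [Finset.mem_product, Nat.mem_divisors]
    have h0 : l ≠ 0 := by omega
    exact ⟨⟨hp' ▸ Nat.dvd_lcm_left _ _, h0⟩, ⟨hp' ▸ Nat.dvd_lcm_right _ _, h0⟩⟩
  rw [Finset.card_eq_sum_card_fiberwise hmaps, Finset.sum_product, Finset.mul_sum]
  refine Finset.sum_congr rfl fun i hi => ?_
  rw [Finset.mul_sum]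
  refine Finset.sum_congr rfl fun j hj => ?_
  split_ifs with h
  · have e : l * (Nat.gcd i j * cycleCount σ i * cycleCount τ j)
        = (i * cycleCount σ i) * (j * cycleCount τ j) := by
      have := Nat.gcd_mul_lcm i j
      rw [h] at this
      calc _ = (Nat.gcd i j * l) * (cycleCount σ i * cycleCount τ j) := by ring
        _ = _ := by rw [this]; ring
    rw [e, mul_cycleCount σ i (Nat.pos_of_mem_divisors hi),
      mul_cycleCount τ j (Nat.pos_of_mem_divisors hj), ← Finset.card_product]
    congr 1
    ext p
    simp only [Finset.mem_filter, Finset.mem_univ, true_and, Finset.mem_product, hper,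
      Prod.mk.injEq]
    constructor
    · exact fun h => h.2
    · rintro ⟨h1, h2⟩
      exact ⟨by rw [h1, h2, h], h1, h2⟩
  · rw [mul_zero, Finset.card_eq_zero, Finset.filter_eq_empty_iff]
    intro p hp hq
    have hp' := (Finset.mem_filter.1 hp).2
    rw [hper] at hp'
    rw [Prod.mk.injEq] at hq
    rw [hq.1, hq.2] at hp'
    exact h hp'

end Stmt18
end
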